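/- Let X be a nonempty finite set, let H₀, g : X → ℝ, and for λ ∈ ℝ, T > 0 define the classical Gibbs distribution p_{λ,T}(x) = exp(-(H₀(x)+λ·g(x))/T)/Z(λ,T) with Z(λ,T) = ∑_x exp(-(H₀(x)+λ·g(x))/T). Let I(λ;T) = ∑_x p_{λ,T}(x)·(∂_λ ln p_{λ,T}(x))² be the classical Fisher information and S(λ;T) = −∑_x p_{λ,T}(x)·ln p_{λ,T}(x) the Shannon entropy. Then for all λ and T > 0: (i) I(λ;T) = Var_{p_{λ,T}}(g)/T², and (ii) the exact relation ∂_T(T·I(λ;T)) = ∂_λ² S(λ;T) holds (i.e., the high-temperature relation between QFI and entropy curvature becomes exact in the classical case). -/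

import Mathlib

open Filter Asymptotics

/-- The expectation of `f` under the probability weights proportional to `exp (φ x)`. -/
noncomputable def gibbsMean {X : Type*} [Fintype X] (φ f : X → ℝ) : ℝ :=
  (∑ x, Real.exp (φ x) * f x) / ∑ x, Real.exp (φ x)

section GibbsMean

variable {X : Type*} [Fintype X]

theorem sum_exp_pos [Nonempty X] (φ : X → ℝ) : 0 < ∑ x, Real.exp (φ x) :=
  Finset.sum_pos (fun _ _ => Real.exp_pos _) Finset.univ_nonempty

theorem sum_exp_div_mul (φ f : X → ℝ) :
    ∑ x, Real.exp (φ x) / (∑ y, Real.exp (φ y)) * f x = gibbsMean φ f := by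
  rw [gibbsMean, Finset.sum_div]
  exact Finset.sum_congr rfl fun x _ => by ring

theorem gibbsMean_const [Nonempty X] (φ : X → ℝ) (c : ℝ) : gibbsMean φ (fun _ => c) = c := by
  rw [gibbsMean, ← Finset.sum_mul, mul_div_cancel_left₀ _ (sum_exp_pos φ).ne']

theorem gibbsMean_const_mul (φ f : X → ℝ) (c : ℝ) :
    gibbsMean φ (fun x => c * f x) = c * gibbsMean φ f := by
  simp only [gibbsMean, mul_left_comm _ c, ← Finset.mul_sum, mul_div_assoc]

theorem gibbsMean_add (φ f h : X → ℝ) :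
    gibbsMean φ (fun x => f x + h x) = gibbsMean φ f + gibbsMean φ h := by
  simp only [gibbsMean, mul_add, Finset.sum_add_distrib, add_div]

theorem gibbsMean_sub_sq [Nonempty X] (φ f : X → ℝ) :
    gibbsMean φ (fun x => (f x - gibbsMean φ f) ^ 2) =
      gibbsMean φ (fun x => f x ^ 2) - gibbsMean φ f ^ 2 := by
  set m := gibbsMean φ f with hm
  have h : (fun x => (f x - m) ^ 2) = fun x => (f x ^ 2 + (-2 * m) * f x) + m ^ 2 := by
    ext x; ring
  rw [h, gibbsMean_add, gibbsMean_add, gibbsMean_const_mul, gibbsMean_const, ← hm]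
  ring

theorem hasDerivAt_sum_exp {φ : ℝ → X → ℝ} {a : X → ℝ} {t : ℝ}
    (hφ : ∀ x, HasDerivAt (fun s => φ s x) (a x) t) :
    HasDerivAt (fun s => ∑ x, Real.exp (φ s x)) (∑ x, Real.exp (φ t x) * a x) t :=
  HasDerivAt.fun_sum fun x _ => (hφ x).exp

theorem hasDerivAt_log_sum_exp [Nonempty X] {φ : ℝ → X → ℝ} {a : X → ℝ} {t : ℝ}
    (hφ : ∀ x, HasDerivAt (fun s => φ s x) (a x) t) :
    HasDerivAt (fun s => Real.log (∑ x, Real.exp (φ s x))) (gibbsMean (φ t) a) t :=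
  (hasDerivAt_sum_exp hφ).log (sum_exp_pos _).ne'

theorem hasDerivAt_gibbsMean [Nonempty X] {φ f : ℝ → X → ℝ} {a f' : X → ℝ} {t : ℝ}
    (hφ : ∀ x, HasDerivAt (fun s => φ s x) (a x) t)
    (hf : ∀ x, HasDerivAt (fun s => f s x) (f' x) t) :
    HasDerivAt (fun s => gibbsMean (φ s) (f s))
      (gibbsMean (φ t) f' + gibbsMean (φ t) (fun x => a x * f t x)
        - gibbsMean (φ t) a * gibbsMean (φ t) (f t)) t := by
  have hZ := (sum_exp_pos (φ t)).ne'
  have hN : HasDerivAt (fun s => ∑ x, Real.exp (φ s x) * f s x)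
      (∑ x, (Real.exp (φ t x) * a x * f t x + Real.exp (φ t x) * f' x)) t :=
    HasDerivAt.fun_sum fun x _ => (hφ x).exp.mul (hf x)
  refine (hN.div (hasDerivAt_sum_exp hφ) hZ).congr_deriv ?_
  simp only [gibbsMean, Finset.sum_add_distrib, mul_assoc]
  field_simp
  ring

theorem log_exp_div_sum_exp [Nonempty X] (φ : X → ℝ) (x : X) :
    Real.log (Real.exp (φ x) / ∑ y, Real.exp (φ y)) =
      φ x - Real.log (∑ y, Real.exp (φ y)) := by
  rw [Real.log_div (Real.exp_pos _).ne' (sum_exp_pos φ).ne', Real.log_exp]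

theorem neg_gibbsMean_log_eq [Nonempty X] (φ : X → ℝ) :
    -gibbsMean φ (fun x => φ x - Real.log (∑ y, Real.exp (φ y))) =
      Real.log (∑ y, Real.exp (φ y)) - gibbsMean φ φ := by
  simp only [sub_eq_add_neg]
  rw [gibbsMean_add, gibbsMean_const]
  ring

/-- The first derivative of the Shannon entropy along a curve of exponents. -/
theorem hasDerivAt_gibbsEntropy [Nonempty X] {φ : ℝ → X → ℝ} {a : X → ℝ} {t : ℝ}
    (hφ : ∀ x, HasDerivAt (fun s => φ s x) (a x) t) :
    HasDerivAt (fun s => Real.log (∑ y, Real.exp (φ s y)) - gibbsMean (φ s) (φ s))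
      (gibbsMean (φ t) a * gibbsMean (φ t) (φ t) - gibbsMean (φ t) (fun x => a x * φ t x)) t :=
  ((hasDerivAt_log_sum_exp hφ).sub (hasDerivAt_gibbsMean hφ hφ)).congr_deriv (by ring)

/-- The second derivative of the Shannon entropy along an affine curve of exponents. -/
theorem iteratedDeriv_two_gibbsEntropy [Nonempty X] {φ : ℝ → X → ℝ} {a : X → ℝ}
    (hφ : ∀ t x, HasDerivAt (fun s => φ s x) (a x) t) (t : ℝ) :
    iteratedDeriv 2 (fun s => Real.log (∑ y, Real.exp (φ s y)) - gibbsMean (φ s) (φ s)) t =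
      (gibbsMean (φ t) (fun x => a x * a x) - gibbsMean (φ t) a ^ 2) * gibbsMean (φ t) (φ t)
        + gibbsMean (φ t) a * (gibbsMean (φ t) a + gibbsMean (φ t) (fun x => a x * φ t x)
          - gibbsMean (φ t) a * gibbsMean (φ t) (φ t))
        - (gibbsMean (φ t) (fun x => a x * a x) + gibbsMean (φ t) (fun x => a x * (a x * φ t x))
          - gibbsMean (φ t) a * gibbsMean (φ t) (fun x => a x * φ t x)) := by
  rw [iteratedDeriv_succ, iteratedDeriv_one,
    funext fun s => (hasDerivAt_gibbsEntropy (hφ s)).deriv]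
  have ha := hasDerivAt_gibbsMean (hφ t) (fun x => hasDerivAt_const t (a x))
  have hs := hasDerivAt_gibbsMean (hφ t) (hφ t)
  have has := hasDerivAt_gibbsMean (hφ t) (fun x => (hφ t x).const_mul (a x))
  refine ((ha.mul hs).sub has).deriv.trans ?_
  rw [gibbsMean_const]
  ring

end GibbsMean

/-- For a classical Gibbs distribution with linearly coupled parameter:
(i) the classical Fisher information is `Var(g)/T²`, and (ii) the exact relation
`∂_T (T ⬝ I(λ;T)) = ∂_λ² S(λ;T)` holds. -/
theorem stmt17 (X : Type*) [Fintype X] [Nonempty X]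
    (H₀ g : X → ℝ)
    (Z : ℝ → ℝ → ℝ)
    (hZ : ∀ lam T, Z lam T = ∑ x, Real.exp (-(H₀ x + lam * g x) / T))
    (p : ℝ → ℝ → X → ℝ)
    (hp : ∀ lam T x, p lam T x = Real.exp (-(H₀ x + lam * g x) / T) / Z lam T)
    (I S : ℝ → ℝ → ℝ)
    (hI : ∀ lam T, I lam T =
      ∑ x, p lam T x * (deriv (fun lam' => Real.log (p lam' T x)) lam) ^ 2)
    (hS : ∀ lam T, S lam T = -∑ x, p lam T x * Real.log (p lam T x)) :
    ∀ (lam T : ℝ), 0 < T →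
      (I lam T =
        ((∑ x, p lam T x * g x ^ 2) - (∑ x, p lam T x * g x) ^ 2) / T ^ 2) ∧
      deriv (fun T' => T' * I lam T') T = iteratedDeriv 2 (fun lam' => S lam' T) lam := by
  set φ : ℝ → ℝ → X → ℝ := fun lam T x => -(H₀ x + lam * g x) / T with hφ
  have hp' (lam T x) : p lam T x = Real.exp (φ lam T x) / ∑ y, Real.exp (φ lam T y) := by
    rw [hp, hZ]
  have hmean (lam T) (f : X → ℝ) : ∑ x, p lam T x * f x = gibbsMean (φ lam T) f := by
    simp only [hp', sum_exp_div_mul]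
  have hlog (lam T x) :
      Real.log (p lam T x) = φ lam T x - Real.log (∑ y, Real.exp (φ lam T y)) := by
    rw [hp', log_exp_div_sum_exp]
  have hφlam (T lam x) : HasDerivAt (fun s => φ s T x) (-T⁻¹ * g x) lam :=
    ((((hasDerivAt_id lam).mul_const (g x)).const_add (H₀ x)).neg.div_const T).congr_deriv
      (by ring)
  have hφT (lam : ℝ) {T : ℝ} (hT : T ≠ 0) (x) :
      HasDerivAt (fun s => φ lam s x) (-T⁻¹ * φ lam T x) T :=
    ((hasDerivAt_const T (-(H₀ x + lam * g x))).div (hasDerivAt_id T) hT).congr_deriv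
      (by simp only [hφ, id]; field_simp; ring)
  have hFisher (lam T) : I lam T =
      (gibbsMean (φ lam T) (fun x => g x ^ 2) - gibbsMean (φ lam T) g ^ 2) / T ^ 2 := by
    have hscore (x) : deriv (fun s => Real.log (p s T x)) lam =
        -T⁻¹ * g x - gibbsMean (φ lam T) (fun y => -T⁻¹ * g y) := by
      simp only [hlog]
      exact ((hφlam T lam x).sub (hasDerivAt_log_sum_exp (hφlam T lam))).deriv
    simp only [hI, hscore, hmean]
    rw [gibbsMean_sub_sq]
    simp only [mul_pow, gibbsMean_const_mul]
    ring
  have hEntropy (T) : (fun lam => S lam T) = fun lam =>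
      Real.log (∑ y, Real.exp (φ lam T y)) - gibbsMean (φ lam T) (φ lam T) := by
    ext lam
    simp only [hS, hmean, hlog, neg_gibbsMean_log_eq]
  intro lam T hT
  refine ⟨by rw [hFisher, hmean, hmean], ?_⟩
  have hT0 := hT.ne'
  have hTI : (fun T' => T' * I lam T') = fun T' =>
      (gibbsMean (φ lam T') (fun x => g x ^ 2) - gibbsMean (φ lam T') g ^ 2) / T' := by
    ext T'
    rw [hFisher]
    rcases eq_or_ne T' 0 with rfl | h
    · simp
    · field_simp
  have hg := hasDerivAt_gibbsMean (hφT lam hT0) (fun x => hasDerivAt_const T (g x))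
  have hg2 := hasDerivAt_gibbsMean (hφT lam hT0) (fun x => hasDerivAt_const T (g x ^ 2))
  rw [hTI, hEntropy, iteratedDeriv_two_gibbsEntropy (hφlam T)]
  refine ((hg2.sub (hg.pow 2)).div (hasDerivAt_id T) hT0).deriv.trans ?_
  have h₁ : (fun x => -T⁻¹ * g x * (-T⁻¹ * g x)) = fun x => T⁻¹ ^ 2 * g x ^ 2 := by
    ext x; ring
  have h₂ : (fun x => -T⁻¹ * g x * (-T⁻¹ * g x * φ lam T x)) =
      fun x => T⁻¹ ^ 2 * (φ lam T x * g x ^ 2) := by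
    ext x; ring
  have h₃ : (fun x => -T⁻¹ * g x * φ lam T x) = fun x => -T⁻¹ * (φ lam T x * g x) := by
    ext x; ring
  simp only [h₁, h₂, h₃, mul_assoc (-T⁻¹) (φ lam T _), gibbsMean_const_mul, gibbsMean_const,
    Pi.sub_apply, Pi.pow_apply, id]
  field_simp
  ring
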